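/- Let 1/2 < s < 1 and 1 < a < min(2s, 2 − s). Then there exists a constant C > 0 such that for all Schwartz functions u, v on ℝ², ‖uv‖_{H^{1−s}} ≤ C (‖u‖_{L^∞} + ‖u‖_{Ḣ^a}) ‖v‖_{H^{1−s}}. -/

import Mathlib

open MeasureTheory Real
open scoped FourierTransform

noncomputable section

abbrev Plane := EuclideanSpace ℝ (Fin 2)

/-- The inhomogeneous Sobolev norm `‖f‖_{H^s} = (∫ (1+|ξ|²)^s |f̂(ξ)|² dξ)^{1/2}` on ℝ². -/
def sobNorm (s : ℝ) (f : Plane → ℂ) : ℝ :=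
  (∫ ξ : Plane, (1 + ‖ξ‖ ^ 2) ^ s * ‖𝓕 f ξ‖ ^ 2) ^ (1/2 : ℝ)

/-- The homogeneous Sobolev norm `‖f‖_{Ḣ^s} = (∫ |ξ|^{2s} |f̂(ξ)|² dξ)^{1/2}` on ℝ². -/
def homNorm (s : ℝ) (f : Plane → ℂ) : ℝ :=
  (∫ ξ : Plane, ‖ξ‖ ^ (2 * s) * ‖𝓕 f ξ‖ ^ 2) ^ (1/2 : ℝ)

/-- Peetre-type inequality. -/
lemma one_add_sq_rpow_le {σ x y z : ℝ} (hσ0 : 0 ≤ σ) (hσ1 : σ ≤ 1) (hx : 0 ≤ x) (hz : 0 ≤ z)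
    (h : z ≤ x + y) : (1 + z ^ 2) ^ (σ / 2) ≤ (1 + x) * (1 + y ^ 2) ^ (σ / 2) := by
  have h1 : 1 + z ^ 2 ≤ (1 + x) ^ 2 * (1 + y ^ 2) := by
    nlinarith [mul_nonneg hx (sq_nonneg (1 - y)), mul_nonneg (sq_nonneg x) (sq_nonneg y)]
  calc (1 + z ^ 2) ^ (σ / 2) ≤ ((1 + x) ^ 2 * (1 + y ^ 2)) ^ (σ / 2) := by gcongr
    _ = (1 + x) ^ σ * (1 + y ^ 2) ^ (σ / 2) := by
      rw [mul_rpow (by positivity) (by positivity), ← rpow_natCast, ← rpow_mul (by positivity)]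
      congr 2; push_cast; ring
    _ ≤ (1 + x) * (1 + y ^ 2) ^ (σ / 2) := by
      gcongr
      exact rpow_le_self_of_one_le (by linarith) hσ1

lemma one_add_sq_rpow_le_two_mul {σ y z : ℝ} (hσ0 : 0 ≤ σ) (hσ1 : σ ≤ 1) (hz : 0 ≤ z)
    (h : z ≤ 2 * y) : (1 + z ^ 2) ^ (σ / 2) ≤ 2 * (1 + y ^ 2) ^ (σ / 2) := by
  calc (1 + z ^ 2) ^ (σ / 2) ≤ ((2 : ℝ) ^ 2 * (1 + y ^ 2)) ^ (σ / 2) := by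
        gcongr; nlinarith
    _ = 2 ^ σ * (1 + y ^ 2) ^ (σ / 2) := by
      rw [mul_rpow (by positivity) (by positivity), ← rpow_natCast, ← rpow_mul (by positivity)]
      congr 2; push_cast; ring
    _ ≤ 2 * (1 + y ^ 2) ^ (σ / 2) := by
      gcongr
      exact rpow_le_self_of_one_le (by norm_num) hσ1

/-- Commutator bound for the Bessel weight. -/
lemma abs_one_add_sq_rpow_sub_le {σ a x y z : ℝ} (hσ0 : 0 ≤ σ) (hσ1 : σ ≤ 1) (hσa : σ ≤ a)
    (ha2 : a ≤ 2) (hx : 0 ≤ x) (hy : 0 ≤ y) (hz : 0 ≤ z) (hzxy : z ≤ x + y) (hyxz : y ≤ x + z) :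
    |(1 + z ^ 2) ^ (σ / 2) - (1 + y ^ 2) ^ (σ / 2)| ≤
      4 * (min x 1 * x ^ (-a) * x ^ a * (1 + y ^ 2) ^ (σ / 2)
        + x ^ a * ((1 + y ^ 2) ^ (-a / 2) * (1 + y ^ 2) ^ (σ / 2))) := by
  rcases hx.eq_or_lt with rfl | hx0
  · have : z = y := by linarith
    subst this
    rw [sub_self, abs_zero]
    positivity
  have hxa : min x 1 * x ^ (-a) * x ^ a = min x 1 := by
    rw [mul_assoc, ← rpow_add hx0]; simp
  rw [hxa]
  have hY : 0 < (1 + y ^ 2) ^ (σ / 2) := by positivity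
  have hZ : 0 < (1 + z ^ 2) ^ (σ / 2) := by positivity
  have hW : 0 ≤ x ^ a * ((1 + y ^ 2) ^ (-a / 2) * (1 + y ^ 2) ^ (σ / 2)) := by positivity
  rcases le_total x 1 with hx1 | hx1
  · rw [min_eq_left hx1]
    have h1 := one_add_sq_rpow_le hσ0 hσ1 hx hz hzxy
    have h2 := one_add_sq_rpow_le hσ0 hσ1 hx hy hyxz
    rw [abs_le]
    constructor
    · nlinarith [mul_le_mul_of_nonneg_left h1 hx, mul_pos hx0 hY,
        mul_le_mul_of_nonneg_right hx1 (mul_pos hx0 hY).le]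
    · nlinarith [mul_pos hx0 hY]
  rw [min_eq_right hx1]
  rcases le_total x y with hxy | hxy
  · have h1 := one_add_sq_rpow_le_two_mul hσ0 hσ1 hz (show z ≤ 2 * y by linarith)
    rw [abs_le]
    constructor <;> linarith
  · have h1 := one_add_sq_rpow_le_two_mul hσ0 hσ1 hz (show z ≤ 2 * x by linarith)
    have h2 : (1 + y ^ 2) ^ (σ / 2) ≤ (1 + x ^ 2) ^ (σ / 2) := by gcongr
    have h3 : (1 + x ^ 2) ^ (σ / 2) ≤
        2 * (x ^ a * ((1 + y ^ 2) ^ (-a / 2) * (1 + y ^ 2) ^ (σ / 2))) := by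
      calc (1 + x ^ 2) ^ (σ / 2) = (1 + x ^ 2) ^ (a / 2) * (1 + x ^ 2) ^ ((σ - a) / 2) := by
            rw [← rpow_add (by positivity)]; congr 1; ring
        _ ≤ (2 * x ^ 2) ^ (a / 2) * (1 + y ^ 2) ^ ((σ - a) / 2) := by
            gcongr ?_ * ?_
            · gcongr
              · linarith
              · nlinarith
            · exact rpow_le_rpow_of_nonpos (by positivity) (by gcongr) (by linarith)
        _ = 2 ^ (a / 2) * (x ^ a * ((1 + y ^ 2) ^ (-a / 2) * (1 + y ^ 2) ^ (σ / 2))) := by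
            rw [mul_rpow (by norm_num) (by positivity), ← rpow_natCast, ← rpow_mul hx,
              ← rpow_add (by positivity), mul_assoc]
            congr 3
            · push_cast; ring
            · ring
        _ ≤ 2 * (x ^ a * ((1 + y ^ 2) ^ (-a / 2) * (1 + y ^ 2) ^ (σ / 2))) := by
            gcongr
            exact rpow_le_self_of_one_le (by norm_num) (by linarith)
    rw [abs_le]
    constructor <;> linarith

lemma sq_lintegral_mul_le {α : Type*} [MeasurableSpace α] {μ : Measure α} {f g : α → ENNReal}
    (hf : AEMeasurable f μ) (hg : AEMeasurable g μ) :
    (∫⁻ x, f x * g x ∂μ) ^ 2 ≤ (∫⁻ x, f x ^ 2 ∂μ) * ∫⁻ x, g x ^ 2 ∂μ := by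
  have h := ENNReal.lintegral_mul_le_Lp_mul_Lq μ Real.HolderConjugate.two_two hf hg
  simp only [Pi.mul_apply, ENNReal.rpow_two] at h
  calc (∫⁻ x, f x * g x ∂μ) ^ 2 ≤ _ := pow_le_pow_left' h 2
    _ = _ := by
      rw [mul_pow, ← ENNReal.rpow_two, ← ENNReal.rpow_two, ← ENNReal.rpow_mul,
        ← ENNReal.rpow_mul]
      norm_num

/-- Young's convolution inequality `L¹ * L² ⊆ L²`. -/
lemma lintegral_sq_convolution_le {G : Type*} [MeasurableSpace G] [AddCommGroup G]
    [MeasurableAdd₂ G] [MeasurableNeg G] {μ : Measure G} [SFinite μ] [μ.IsAddRightInvariant]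
    {k w : G → ENNReal} (hk : Measurable k) (hw : Measurable w) :
    ∫⁻ x, (∫⁻ t, k t * w (x - t) ∂μ) ^ 2 ∂μ ≤ (∫⁻ t, k t ∂μ) ^ 2 * ∫⁻ x, w x ^ 2 ∂μ := by
  have key (x : G) : (∫⁻ t, k t * w (x - t) ∂μ) ^ 2 ≤
      (∫⁻ t, k t ∂μ) * ∫⁻ t, k t * w (x - t) ^ 2 ∂μ := by
    have h := sq_lintegral_mul_le (μ := μ) (f := fun t => k t ^ (1 / 2 : ℝ))
      (g := fun t => k t ^ (1 / 2 : ℝ) * w (x - t)) (by fun_prop) (by fun_prop)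
    have e (t : G) : k t ^ (1 / 2 : ℝ) * k t ^ (1 / 2 : ℝ) = k t := by
      rw [← ENNReal.rpow_add_of_nonneg _ _ (by norm_num) (by norm_num)]; norm_num
    have e' (t : G) : (k t ^ (1 / 2 : ℝ)) ^ 2 = k t := by rw [sq, e]
    simpa only [mul_pow, ← mul_assoc, e, e'] using h
  calc ∫⁻ x, (∫⁻ t, k t * w (x - t) ∂μ) ^ 2 ∂μ
      ≤ ∫⁻ x, (∫⁻ t, k t ∂μ) * ∫⁻ t, k t * w (x - t) ^ 2 ∂μ ∂μ := lintegral_mono key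
    _ = (∫⁻ t, k t ∂μ) * ∫⁻ x, ∫⁻ t, k t * w (x - t) ^ 2 ∂μ ∂μ :=
        lintegral_const_mul _ (Measurable.lintegral_prod_right'
          (f := fun p : G × G => k p.2 * w (p.1 - p.2) ^ 2) (by fun_prop))
    _ = (∫⁻ t, k t ∂μ) * ∫⁻ t, ∫⁻ x, k t * w (x - t) ^ 2 ∂μ ∂μ := by
        rw [lintegral_lintegral_swap]
        fun_prop
    _ = (∫⁻ t, k t ∂μ) * ∫⁻ t, k t * ∫⁻ x, w x ^ 2 ∂μ ∂μ := by
        congr 1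
        refine lintegral_congr fun t => ?_
        rw [lintegral_const_mul _ (by fun_prop),
          lintegral_sub_right_eq_self (fun x => w x ^ 2) t]
    _ = _ := by rw [lintegral_mul_const _ hk, sq, mul_assoc]

lemma integrable_min_norm_one_mul_rpow_sq {a : ℝ} (ha : 1 < a) (ha2 : a < 2) :
    Integrable (fun x : Plane => (min ‖x‖ 1 * ‖x‖ ^ (-a)) ^ 2) := by
  refine (integrable_fun_norm_addHaar volume
    (f := fun r : ℝ => (min r 1 * r ^ (-a)) ^ 2)).mpr ?_
  simp only [finrank_euclideanSpace, Fintype.card_fin, smul_eq_mul]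
  rw [← Set.Ioc_union_Ioi_eq_Ioi zero_le_one]
  refine IntegrableOn.union ?_ ?_
  · have h : IntegrableOn (fun r : ℝ => r ^ (3 - 2 * a)) (Set.Ioc 0 1) := by
      rw [← intervalIntegrable_iff_integrableOn_Ioc_of_le zero_le_one]
      exact intervalIntegral.intervalIntegrable_rpow' (by linarith)
    refine h.congr_fun (fun r hr => ?_) measurableSet_Ioc
    have hr0 : 0 < r := hr.1
    simp only [min_eq_left hr.2]
    rw [mul_pow, ← rpow_natCast (r ^ (-a)), ← rpow_mul hr0.le, sub_eq_add_neg, rpow_add hr0]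
    norm_num
    rw [show a * 2 = 2 * a by ring]
    ring
  · have h : IntegrableOn (fun r : ℝ => r ^ (1 - 2 * a)) (Set.Ioi 1) :=
      integrableOn_Ioi_rpow_of_lt (by linarith) one_pos
    refine h.congr_fun (fun r hr => ?_) measurableSet_Ioi
    have hr1 : 1 < r := hr
    have hr0 : 0 < r := by linarith
    simp only [min_eq_right hr1.le]
    rw [mul_pow, ← rpow_natCast (r ^ (-a)), ← rpow_mul hr0.le, sub_eq_add_neg, rpow_add hr0]
    norm_num
    exact Or.inl (by rw [mul_comm])

lemma fourier_fourier_apply (f : SchwartzMap Plane ℂ) (x : Plane) : 𝓕 (𝓕 f) x = f (-x) := by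
  have h : 𝓕⁻ (𝓕 f) (-x) = f (-x) := by simp
  rw [SchwartzMap.fourierInv_coe, Real.fourierInv_eq_fourier_neg, neg_neg] at h
  exact h

/-- The Fourier transform turns products into convolutions. -/
lemma fourier_mul_eq_integral (u v : SchwartzMap Plane ℂ) (ξ : Plane) :
    𝓕 (fun x => u x * v x) ξ = ∫ t, 𝓕 u t * 𝓕 v (ξ - t) := by
  set B := ContinuousLinearMap.mul ℂ ℂ
  have h1 : 𝓕 (SchwartzMap.pairing B u v) = SchwartzMap.convolution B (𝓕 u) (𝓕 v) := by
    have h2 : 𝓕 (𝓕 (SchwartzMap.pairing B u v)) =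
        𝓕 (SchwartzMap.convolution B (𝓕 u) (𝓕 v)) := by
      ext x
      rw [SchwartzMap.fourier_convolution]
      simp [fourier_fourier_apply, B]
    simpa using congrArg (fun f => 𝓕⁻ f) h2
  have h3 := DFunLike.congr_fun h1 ξ
  rw [SchwartzMap.convolution_apply] at h3
  exact h3

lemma integrable_norm_sq_schwartz (f : SchwartzMap Plane ℂ) : Integrable (fun x => ‖f x‖ ^ 2) :=
  (memLp_two_iff_integrable_sq_norm f.continuous.aestronglyMeasurable).mp (f.memLp 2)

lemma lintegral_sq_enorm_schwartz (f : SchwartzMap Plane ℂ) :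
    ∫⁻ x, ‖f x‖ₑ ^ 2 = ENNReal.ofReal (∫ x, ‖f x‖ ^ 2) := by
  rw [ofReal_integral_eq_lintegral_ofReal (integrable_norm_sq_schwartz f)
    (.of_forall fun x => by positivity)]
  simp [ENNReal.ofReal_pow, ofReal_norm]

lemma integrable_mul_sub_schwartz (f g : SchwartzMap Plane ℂ) (ξ : Plane) :
    Integrable (fun t => f t * g (ξ - t)) := by
  refine f.integrable.mul_bdd (c := ‖g.toBoundedContinuousFunction‖)
    (g.continuous.comp (by fun_prop)).aestronglyMeasurable (.of_forall fun t => ?_)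
  exact g.toBoundedContinuousFunction.norm_coe_le_norm (ξ - t)

lemma bddAbove_range_norm_schwartz (u : SchwartzMap Plane ℂ) :
    BddAbove (Set.range fun x => ‖u x‖) :=
  ⟨‖u.toBoundedContinuousFunction‖, by
    rintro _ ⟨x, rfl⟩
    exact u.toBoundedContinuousFunction.norm_coe_le_norm x⟩

/-- Multiplication by a bounded function on `L²`, seen on the Fourier side. -/
lemma lintegral_sq_enorm_fourier_mul_le (u g : SchwartzMap Plane ℂ) :
    ∫⁻ ξ, ‖𝓕 (fun x => u x * g x) ξ‖ₑ ^ 2 ≤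
      ENNReal.ofReal ((⨆ x, ‖u x‖) ^ 2 * ∫ ξ, ‖𝓕 g ξ‖ ^ 2) := by
  set P := SchwartzMap.pairing (ContinuousLinearMap.mul ℂ ℂ) u g
  have h := lintegral_sq_enorm_schwartz (𝓕 P)
  rw [SchwartzMap.integral_norm_sq_fourier] at h
  refine h.le.trans (ENNReal.ofReal_le_ofReal ?_)
  rw [SchwartzMap.integral_norm_sq_fourier, ← integral_const_mul]
  refine integral_mono (integrable_norm_sq_schwartz P)
    ((integrable_norm_sq_schwartz g).const_mul _) fun x => ?_
  simp only [P, SchwartzMap.pairing_apply_apply, ContinuousLinearMap.mul_apply', norm_mul, mul_pow]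
  gcongr
  exact le_ciSup (bddAbove_range_norm_schwartz u) x

lemma ENNReal.add_sq_le_four_mul (x y : ENNReal) : (x + y) ^ 2 ≤ 4 * (x ^ 2 + y ^ 2) := by
  wlog h : x ≤ y generalizing x y
  · rw [add_comm x, add_comm (x ^ 2)]
    exact this y x (le_of_not_ge h)
  calc (x + y) ^ 2 ≤ (y + y) ^ 2 := by gcongr
    _ = 4 * y ^ 2 := by ring
    _ ≤ 4 * (x ^ 2 + y ^ 2) := by gcongr; exact le_add_self

/-- Multiplication of a Schwartz function by the Bessel weight `(1 + ‖x‖ ^ 2) ^ r`. -/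
def besselMul (r : ℝ) (f : SchwartzMap Plane ℂ) : SchwartzMap Plane ℂ :=
  SchwartzMap.smulLeftCLM ℂ (fun x : Plane => (1 + ‖x‖ ^ 2) ^ r) f

lemma besselMul_apply (r : ℝ) (f : SchwartzMap Plane ℂ) (x : Plane) :
    besselMul r f x = (((1 + ‖x‖ ^ 2) ^ r : ℝ) : ℂ) * f x := by
  rw [besselMul, SchwartzMap.smulLeftCLM_apply_apply (by fun_prop), Complex.real_smul]

lemma norm_besselMul_apply (r : ℝ) (f : SchwartzMap Plane ℂ) (x : Plane) :
    ‖besselMul r f x‖ = (1 + ‖x‖ ^ 2) ^ r * ‖f x‖ := by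
  rw [besselMul_apply, norm_mul, Complex.norm_of_nonneg (by positivity)]

lemma norm_besselMul_apply_sq (r : ℝ) (f : SchwartzMap Plane ℂ) (x : Plane) :
    ‖besselMul (r / 2) f x‖ ^ 2 = (1 + ‖x‖ ^ 2) ^ r * ‖f x‖ ^ 2 := by
  rw [norm_besselMul_apply, mul_pow, ← rpow_natCast (_ ^ (r / 2)), ← rpow_mul (by positivity)]
  congr 2; push_cast; ring

lemma integrable_norm_rpow_mul_sq_schwartz {a : ℝ} (ha : 0 ≤ a) (f : SchwartzMap Plane ℂ) :
    Integrable (fun x => ‖x‖ ^ (2 * a) * ‖f x‖ ^ 2) := by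
  refine Integrable.mono' (integrable_norm_sq_schwartz (besselMul (a / 2) f))
    ?_ (.of_forall fun x => ?_)
  · have := f.continuous.measurable
    exact Measurable.aestronglyMeasurable (by fun_prop)
  · rw [norm_of_nonneg (by positivity)]
    refine le_trans ?_ (norm_besselMul_apply_sq a f x).ge
    gcongr
    rw [rpow_mul (norm_nonneg _), rpow_two]
    gcongr
    linarith

/-- The Bessel weight commutes with the product up to two convolutions, on the Fourier side. -/
lemma enorm_besselWeight_mul_fourier_mul_le {σ a : ℝ} (hσ0 : 0 ≤ σ) (hσ1 : σ ≤ 1) (hσa : σ ≤ a)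
    (ha2 : a ≤ 2) (u v : SchwartzMap Plane ℂ) (ξ : Plane) :
    ‖(((1 + ‖ξ‖ ^ 2) ^ (σ / 2) : ℝ) : ℂ) * 𝓕 (fun x => u x * v x) ξ‖ₑ ≤
      ‖𝓕 (fun x => u x * (𝓕⁻ (besselMul (σ / 2) (𝓕 v)) : SchwartzMap Plane ℂ) x) ξ‖ₑ
      + 4 * ((∫⁻ t, (ENNReal.ofReal (min ‖t‖ 1 * ‖t‖ ^ (-a)) *
              ENNReal.ofReal (‖t‖ ^ a * ‖𝓕 u t‖)) * ‖besselMul (σ / 2) (𝓕 v) (ξ - t)‖ₑ)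
        + ∫⁻ t, (ENNReal.ofReal ((1 + ‖t‖ ^ 2) ^ (-a / 2)) * ‖besselMul (σ / 2) (𝓕 v) t‖ₑ) *
            ENNReal.ofReal (‖ξ - t‖ ^ a * ‖𝓕 u (ξ - t)‖)) := by
  set V := besselMul (σ / 2) (𝓕 v) with hV
  have mU : Measurable fun x => 𝓕 u x := (𝓕 u).continuous.measurable
  have mV : Measurable fun x => V x := V.continuous.measurable
  have hsplit : (((1 + ‖ξ‖ ^ 2) ^ (σ / 2) : ℝ) : ℂ) * 𝓕 (fun x => u x * v x) ξ =
      𝓕 (fun x => u x * (𝓕⁻ V : SchwartzMap Plane ℂ) x) ξ +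
      ∫ t, ((((1 + ‖ξ‖ ^ 2) ^ (σ / 2) - (1 + ‖ξ - t‖ ^ 2) ^ (σ / 2) : ℝ) : ℂ)
        * (𝓕 u t * 𝓕 v (ξ - t))) := by
    rw [fourier_mul_eq_integral, fourier_mul_eq_integral, FourierTransform.fourier_fourierInv_eq,
      ← integral_const_mul, ← sub_eq_iff_eq_add', ← integral_sub
        ((integrable_mul_sub_schwartz (𝓕 u) (𝓕 v) ξ).const_mul _)
        (integrable_mul_sub_schwartz (𝓕 u) V ξ)]
    refine integral_congr_ae (.of_forall fun t => ?_)
    simp only [hV, besselMul_apply]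
    push_cast
    ring
  have hsub : ∫⁻ t, (ENNReal.ofReal ((1 + ‖t‖ ^ 2) ^ (-a / 2)) * ‖V t‖ₑ) *
            ENNReal.ofReal (‖ξ - t‖ ^ a * ‖𝓕 u (ξ - t)‖) =
      ∫⁻ t, (ENNReal.ofReal ((1 + ‖ξ - t‖ ^ 2) ^ (-a / 2)) * ‖V (ξ - t)‖ₑ) *
            ENNReal.ofReal (‖t‖ ^ a * ‖𝓕 u t‖) := by
    rw [← lintegral_sub_left_eq_self _ ξ]
    simp only [sub_sub_cancel]
  rw [hsplit, hsub]
  refine (enorm_add_le _ _).trans (add_le_add le_rfl ?_)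
  refine (enorm_integral_le_lintegral_enorm _).trans ?_
  rw [← lintegral_add_left (by fun_prop), ← lintegral_const_mul _ (by fun_prop)]
  refine lintegral_mono fun t => ?_
  have hcomm := abs_one_add_sq_rpow_sub_le hσ0 hσ1 hσa ha2 (norm_nonneg t) (norm_nonneg (ξ - t))
    (norm_nonneg ξ) (by simpa using norm_add_le t (ξ - t))
    (by simpa [add_comm] using norm_sub_le ξ t)
  rw [← ofReal_norm, ← ofReal_norm, norm_besselMul_apply, norm_mul, norm_mul, Complex.norm_real,
    norm_eq_abs, ← ENNReal.ofReal_mul (by positivity), ← ENNReal.ofReal_mul (by positivity),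
    ← ENNReal.ofReal_mul (by positivity), ← ENNReal.ofReal_mul (by positivity),
    ← ENNReal.ofReal_add (by positivity) (by positivity),
    show (4 : ENNReal) = ENNReal.ofReal 4 by simp, ← ENNReal.ofReal_mul (by positivity)]
  refine ENNReal.ofReal_le_ofReal ((mul_le_mul_of_nonneg_right hcomm
    (by positivity)).trans_eq ?_)
  ring

lemma lintegral_sq_besselWeight_mul_fourier_mul_le {σ a : ℝ} (hσ0 : 0 ≤ σ) (hσ1 : σ ≤ 1)
    (ha : 1 < a) (ha2 : a < 2) (u v : SchwartzMap Plane ℂ) :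
    ∫⁻ ξ, ‖(((1 + ‖ξ‖ ^ 2) ^ (σ / 2) : ℝ) : ℂ) * 𝓕 (fun x => u x * v x) ξ‖ₑ ^ 2 ≤
      ENNReal.ofReal ((4 * (⨆ x, ‖u x‖) ^ 2 +
        256 * ((∫ x : Plane, (min ‖x‖ 1 * ‖x‖ ^ (-a)) ^ 2)
          + ∫ x : Plane, (1 + ‖x‖ ^ 2) ^ (-(2 * a) / 2)) *
          ∫ ξ, ‖ξ‖ ^ (2 * a) * ‖𝓕 u ξ‖ ^ 2) * ∫ ξ, ‖besselMul (σ / 2) (𝓕 v) ξ‖ ^ 2) := by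
  set V := besselMul (σ / 2) (𝓕 v) with hV
  have mU : Measurable fun x => 𝓕 u x := (𝓕 u).continuous.measurable
  have mV : Measurable fun x => V x := V.continuous.measurable
  set m : Plane → ENNReal := fun t => ENNReal.ofReal (min ‖t‖ 1 * ‖t‖ ^ (-a)) with hm
  set F : Plane → ENNReal := fun t => ENNReal.ofReal (‖t‖ ^ a * ‖𝓕 u t‖) with hF
  set w : Plane → ENNReal := fun t => ENNReal.ofReal ((1 + ‖t‖ ^ 2) ^ (-a / 2)) with hw
  have mm : Measurable m := by fun_prop
  have mF : Measurable F := by fun_prop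
  have mw : Measurable w := by fun_prop
  have em : ∫⁻ t, m t ^ 2 = ENNReal.ofReal (∫ x : Plane, (min ‖x‖ 1 * ‖x‖ ^ (-a)) ^ 2) := by
    rw [ofReal_integral_eq_lintegral_ofReal (integrable_min_norm_one_mul_rpow_sq ha ha2)
      (.of_forall fun x => by positivity)]
    refine lintegral_congr fun t => ?_
    rw [hm, ENNReal.ofReal_pow (by positivity)]
  have ew : ∫⁻ t, w t ^ 2 = ENNReal.ofReal (∫ x : Plane, (1 + ‖x‖ ^ 2) ^ (-(2 * a) / 2)) := by
    rw [ofReal_integral_eq_lintegral_ofReal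
      (integrable_rpow_neg_one_add_norm_sq (by simp; linarith))
      (.of_forall fun x => by positivity)]
    refine lintegral_congr fun t => ?_
    simp only [hw]
    rw [← ENNReal.ofReal_pow (by positivity), ← rpow_natCast, ← rpow_mul (by positivity)]
    congr 2; push_cast; ring
  have eF : ∫⁻ t, F t ^ 2 = ENNReal.ofReal (∫ ξ, ‖ξ‖ ^ (2 * a) * ‖𝓕 u ξ‖ ^ 2) := by
    rw [ofReal_integral_eq_lintegral_ofReal
      (integrable_norm_rpow_mul_sq_schwartz (by linarith) (𝓕 u))
      (.of_forall fun x => by positivity)]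
    refine lintegral_congr fun t => ?_
    simp only [hF]
    rw [← ENNReal.ofReal_pow (by positivity), mul_pow, ← rpow_natCast (_ ^ a),
      ← rpow_mul (by positivity), mul_comm a]
    norm_num
  have eV := lintegral_sq_enorm_schwartz V
  have hA := lintegral_sq_enorm_fourier_mul_le u (𝓕⁻ V)
  rw [FourierTransform.fourier_fourierInv_eq] at hA
  have hB := (lintegral_sq_convolution_le (μ := volume) (mm.mul mF) mV.enorm).trans
    (mul_le_mul_left (sq_lintegral_mul_le mm.aemeasurable mF.aemeasurable) _)
  have hD := (lintegral_sq_convolution_le (μ := volume) (mw.mul mV.enorm) mF).trans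
    (mul_le_mul_left (sq_lintegral_mul_le mw.aemeasurable mV.enorm.aemeasurable) _)
  simp only [Pi.mul_apply] at hB hD
  rw [em, eF, eV] at hB
  rw [ew, eF, eV] at hD
  set A : Plane → ENNReal := fun ξ => ‖𝓕 (fun x => u x * (𝓕⁻ V : SchwartzMap Plane ℂ) x) ξ‖ₑ
  set B : Plane → ENNReal := fun ξ => ∫⁻ t, m t * F t * ‖V (ξ - t)‖ₑ
  set D : Plane → ENNReal := fun ξ => ∫⁻ t, w t * ‖V t‖ₑ * F (ξ - t)
  have mB : Measurable B := Measurable.lintegral_prod_right'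
    (f := fun p : Plane × Plane => m p.2 * F p.2 * ‖V (p.1 - p.2)‖ₑ) (by fun_prop)
  have mD : Measurable D := Measurable.lintegral_prod_right'
    (f := fun p : Plane × Plane => w p.2 * ‖V p.2‖ₑ * F (p.1 - p.2)) (by fun_prop)
  calc _ ≤ ∫⁻ ξ, (4 * A ξ ^ 2 + (256 * B ξ ^ 2 + 256 * D ξ ^ 2)) := by
        refine lintegral_mono fun ξ => ?_
        calc _ ≤ (A ξ + 4 * (B ξ + D ξ)) ^ 2 := by
              gcongr
              exact enorm_besselWeight_mul_fourier_mul_le hσ0 hσ1 (by linarith) ha2.le u v ξ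
          _ ≤ 4 * (A ξ ^ 2 + (4 * (B ξ + D ξ)) ^ 2) := ENNReal.add_sq_le_four_mul _ _
          _ = 4 * A ξ ^ 2 + 64 * (B ξ + D ξ) ^ 2 := by ring
          _ ≤ 4 * A ξ ^ 2 + 64 * (4 * (B ξ ^ 2 + D ξ ^ 2)) := by
              gcongr
              exact ENNReal.add_sq_le_four_mul _ _
          _ = _ := by ring
    _ = 4 * (∫⁻ ξ, A ξ ^ 2) + (256 * (∫⁻ ξ, B ξ ^ 2) + 256 * ∫⁻ ξ, D ξ ^ 2) := by
        rw [lintegral_add_right _ (by fun_prop), lintegral_add_left (by fun_prop),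
          lintegral_const_mul' _ _ (by simp), lintegral_const_mul' _ _ (by simp),
          lintegral_const_mul' _ _ (by simp)]
    _ ≤ _ := by
        refine (add_le_add (mul_le_mul_right hA _) (add_le_add (mul_le_mul_right hB _)
          (mul_le_mul_right hD _))).trans_eq ?_
        have p1 : 0 ≤ ∫ x : Plane, (min ‖x‖ 1 * ‖x‖ ^ (-a)) ^ 2 :=
          integral_nonneg fun x => by positivity
        have p2 : 0 ≤ ∫ x : Plane, (1 + ‖x‖ ^ 2) ^ (-(2 * a) / 2) :=
          integral_nonneg fun x => by positivity
        have p3 : 0 ≤ ∫ ξ, ‖ξ‖ ^ (2 * a) * ‖𝓕 u ξ‖ ^ 2 :=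
          integral_nonneg fun x => by positivity
        have p4 : 0 ≤ ∫ ξ, ‖V ξ‖ ^ 2 := integral_nonneg fun x => by positivity
        rw [show (4 : ENNReal) = ENNReal.ofReal 4 by simp,
          show (256 : ENNReal) = ENNReal.ofReal 256 by simp]
        simp only [← ENNReal.ofReal_mul, p1, p2, p3, p4, mul_nonneg, Nat.ofNat_nonneg]
        rw [← ENNReal.ofReal_add (by positivity) (by positivity),
          ← ENNReal.ofReal_add (by positivity) (by positivity)]
        congr 1
        ring

theorem product_estimate_Linfty_Ha (s a : ℝ)
    (hs : 1/2 < s) (hs1 : s < 1) (ha : 1 < a) (ha1 : a < min (2 * s) (2 - s)) :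
    ∃ C > 0, ∀ u v : SchwartzMap Plane ℂ,
      sobNorm (1 - s) (fun x => u x * v x) ≤
        C * ((⨆ x : Plane, ‖u x‖) + homNorm a (fun x => u x)) *
          sobNorm (1 - s) (fun x => v x) := by
  have ha2 : a < 2 := by linarith [ha1.trans_le (min_le_right _ _)]
  set κ := (∫ x : Plane, (min ‖x‖ 1 * ‖x‖ ^ (-a)) ^ 2)
    + ∫ x : Plane, (1 + ‖x‖ ^ 2) ^ (-(2 * a) / 2) with hκ
  have hκ0 : 0 ≤ κ := add_nonneg (integral_nonneg fun x => by positivity)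
    (integral_nonneg fun x => by positivity)
  refine ⟨√(4 + 256 * κ), by positivity, fun u v => ?_⟩
  have key := lintegral_sq_besselWeight_mul_fourier_mul_le (σ := 1 - s) (by linarith)
    (by linarith) ha ha2 u v
  rw [← hκ] at key
  simp only [norm_besselMul_apply_sq] at key
  have hM : 0 ≤ ⨆ x, ‖u x‖ := Real.iSup_nonneg fun x => norm_nonneg _
  set M := ⨆ x, ‖u x‖
  simp only [sobNorm, homNorm, ← sqrt_eq_rpow]
  simp only [← SchwartzMap.fourier_coe]
  set H := ∫ ξ, ‖ξ‖ ^ (2 * a) * ‖𝓕 u ξ‖ ^ 2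
  set S := ∫ ξ, (1 + ‖ξ‖ ^ 2) ^ (1 - s) * ‖𝓕 v ξ‖ ^ 2
  have hH : 0 ≤ H := integral_nonneg fun x => by positivity
  have hS : 0 ≤ S := integral_nonneg fun x => by positivity
  have hle : ∫ ξ, (1 + ‖ξ‖ ^ 2) ^ (1 - s) * ‖𝓕 (fun x => u x * v x) ξ‖ ^ 2 ≤
      (4 * M ^ 2 + 256 * κ * H) * S := by
    have mP : Measurable fun ξ => 𝓕 (fun x => u x * v x) ξ :=
      (𝓕 (SchwartzMap.pairing (ContinuousLinearMap.mul ℂ ℂ) u v)).continuous.measurable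
    rw [integral_eq_lintegral_of_nonneg_ae (.of_forall fun x => by positivity)
      (Measurable.aestronglyMeasurable (by fun_prop))]
    refine ENNReal.toReal_le_of_le_ofReal (by positivity) (le_of_eq_of_le ?_ key)
    refine lintegral_congr fun ξ => ?_
    rw [← ofReal_norm, ← ENNReal.ofReal_pow (by positivity), norm_mul,
      Complex.norm_of_nonneg (by positivity), mul_pow, ← rpow_natCast (_ ^ ((1 - s) / 2)),
      ← rpow_mul (by positivity)]
    congr 3; push_cast; ring
  rw [sqrt_le_left (by positivity), mul_pow, mul_pow, sq_sqrt (by positivity), sq_sqrt hS]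
  refine hle.trans (mul_le_mul_of_nonneg_right ?_ hS)
  have hH2 := sq_sqrt hH
  nlinarith [mul_nonneg hM (sqrt_nonneg H), mul_nonneg hκ0 (sq_nonneg M),
    mul_nonneg hκ0 (mul_nonneg hM (sqrt_nonneg H)), sqrt_nonneg H]

end
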